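/- Let p ≥ 2 be an integer and α ∈ (1,2). There exists a constant C_{p,α}^L > 0 depending only on p and α such that for all n ≥ 1 and each q ∈ {1, 2, ∞}, the induced matrix norm satisfies ‖n^{-α} A_n^L‖_q ≤ C_{p,α}^L, where ‖·‖_1 is the maximum absolute column sum, ‖·‖_∞ is the maximum absolute row sum, and ‖·‖_2 is the spectral norm. -/

import Mathlib

open MeasureTheory

/-- Open uniform knot sequence on [0,1]. -/
noncomputable def knot (p n : ℕ) (i : ℕ) : ℝ :=
  if i ≤ p + 1 then 0 else if n + p + 1 ≤ i then 1 else ((i : ℝ) - ((p : ℝ) + 1)) / n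

/-- B-splines of degree `k` (Cox–de Boor recurrence) on the above knots. -/
noncomputable def bspline (p n : ℕ) : ℕ → ℕ → ℝ → ℝ
  | 0, i, x => if knot p n i ≤ x ∧ x < knot p n (i + 1) then 1 else 0
  | (k + 1), i, x =>
      (if knot p n (i + k + 1) = knot p n i then 0
        else (x - knot p n i) / (knot p n (i + k + 1) - knot p n i) * bspline p n k i x)
      + (if knot p n (i + k + 2) = knot p n (i + 1) then 0
        else (knot p n (i + k + 2) - x) / (knot p n (i + k + 2) - knot p n (i + 1))
              * bspline p n k (i + 1) x)

/-- Greville abscissae. -/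
noncomputable def greville (p n : ℕ) (i : ℕ) : ℝ :=
  (∑ j ∈ Finset.range p, knot p n (i + 1 + j)) / p

/-- Left Riemann–Liouville fractional derivative on `[0,1]`, `α ∈ (1,2)`. -/
noncomputable def RLD0x (α : ℝ) (u : ℝ → ℝ) (x : ℝ) : ℝ :=
  (1 / Real.Gamma (2 - α)) *
    deriv (deriv (fun z => ∫ y in (0:ℝ)..z, (z - y) ^ (1 - α) * u y)) x

/-- Collocation matrix `A_n^L`. -/
noncomputable def ALmat (p n : ℕ) (α : ℝ) : Matrix (Fin (n + p - 2)) (Fin (n + p - 2)) ℝ :=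
  Matrix.of fun i j => RLD0x α (bspline p n p ((j : ℕ) + 2)) (greville p n ((i : ℕ) + 2))

/-- Maximum absolute column sum norm. -/
noncomputable def matNorm1 {N : ℕ} (A : Matrix (Fin N) (Fin N) ℝ) : ℝ :=
  ⨆ j, ∑ i, |A i j|

/-- Maximum absolute row sum norm. -/
noncomputable def matNormInf {N : ℕ} (A : Matrix (Fin N) (Fin N) ℝ) : ℝ :=
  ⨆ i, ∑ j, |A i j|

/-- Spectral norm (operator 2-norm). -/
noncomputable def matNorm2 {N : ℕ} (A : Matrix (Fin N) (Fin N) ℝ) : ℝ :=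
  ‖LinearMap.toContinuousLinearMap (Matrix.toEuclideanLin A)‖

section

open Set Filter Topology

lemma maxpow_hasDerivAt (γ : ℝ) (hγ : 1 < γ) (s : ℝ) :
    HasDerivAt (fun s : ℝ => (max s 0) ^ γ) (γ * (max s 0) ^ (γ - 1)) s := by
  have key : ∀ t : ℝ, 0 ≤ t → HasDerivWithinAt (fun s : ℝ => (max s 0) ^ γ)
      (γ * (max t 0) ^ (γ - 1)) (Ici 0) t := by
    intro t ht
    have h := (Real.hasDerivAt_rpow_const (x := t) (p := γ) (Or.inr hγ.le)).hasDerivWithinAt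
      (s := Ici 0)
    rw [max_eq_left ht]
    refine h.congr (fun y hy => ?_) ?_
    · rw [max_eq_left hy]
    · rw [max_eq_left ht]
  have key2 : ∀ t : ℝ, t ≤ 0 → HasDerivWithinAt (fun s : ℝ => (max s 0) ^ γ)
      (γ * (max t 0) ^ (γ - 1)) (Iic 0) t := by
    intro t ht
    have h := (hasDerivAt_const t (0:ℝ)).hasDerivWithinAt (s := Iic 0)
    rw [max_eq_right ht, Real.zero_rpow (by linarith), mul_zero]
    refine h.congr (fun y hy => ?_) ?_
    · rw [max_eq_right hy, Real.zero_rpow (by linarith)]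
    · rw [max_eq_right ht, Real.zero_rpow (by linarith)]
  rcases lt_trichotomy s 0 with h | h | h
  · exact (key2 s h.le).hasDerivAt (Iic_mem_nhds h)
  · subst h
    have := (key2 0 le_rfl).union (key 0 le_rfl)
    rwa [Iic_union_Ici, hasDerivWithinAt_univ] at this
  · exact (key s h.le).hasDerivAt (Ici_mem_nhds h)

lemma conv_hasDerivAt (K K' w : ℝ → ℝ) (a b x B M ε : ℝ) (hε : 0 < ε)
    (hK : Measurable K) (hK' : Measurable K') (hw : Measurable w)
    (hwM : ∀ y, |w y| ≤ M)
    (hd : ∀ z ∈ Metric.ball x ε, ∀ y ∈ Icc a b, HasDerivAt K (K' (z - y)) (z - y))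
    (hB : ∀ z ∈ Metric.ball x ε, ∀ y ∈ Icc a b, |K' (z - y)| ≤ B) :
    HasDerivAt (fun z => ∫ y in Icc a b, K (z - y) * w y)
      (∫ y in Icc a b, K' (x - y) * w y) x := by
  have hM : 0 ≤ M := (abs_nonneg _).trans (hwM 0)
  refine (hasDerivAt_integral_of_dominated_loc_of_deriv_le (μ := volume.restrict (Icc a b))
    (F := fun z y => K (z - y) * w y) (F' := fun z y => K' (z - y) * w y)
    (bound := fun _ => B * M) (Metric.ball_mem_nhds x hε) ?_ ?_ ?_ ?_ ?_ ?_).2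
  · exact Eventually.of_forall fun z => by
      apply Measurable.aestronglyMeasurable
      fun_prop
  · have hc : ContinuousOn (fun y => K (x - y)) (Icc a b) := by
      intro y hy
      have h1 := (hd x (Metric.mem_ball_self hε) y hy).continuousAt
      exact (ContinuousAt.comp (f := fun y => x - y) (x := y) h1 (by fun_prop)).continuousWithinAt
    have hi : IntegrableOn (fun y => K (x - y)) (Icc a b) := hc.integrableOn_compact isCompact_Icc
    exact Integrable.mul_bdd hi (hw.aestronglyMeasurable) (c := M)
      (Eventually.of_forall hwM)
  · apply Measurable.aestronglyMeasurable
    fun_prop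
  · filter_upwards [ae_restrict_mem measurableSet_Icc] with y hy z hz
    rw [Real.norm_eq_abs, abs_mul]
    exact mul_le_mul (hB z hz y hy) (hwM y) (abs_nonneg _) ((abs_nonneg _).trans (hB z hz y hy))
  · exact integrable_const _
  · filter_upwards [ae_restrict_mem measurableSet_Icc] with y hy z hz
    have h1 := hd z hz y hy
    exact (HasDerivAt.comp_sub_const z y h1).mul_const (w y)

lemma ibp (β : ℝ) (hβ : -1 < β) (w w1 : ℝ → ℝ) (z : ℝ) (hz : 0 ≤ z) (hw : ContinuousOn w (Icc 0 z))
    (hd : ∀ y, HasDerivWithinAt w (w1 y) (Ioi y) y)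
    (hi : IntervalIntegrable w1 volume 0 z) :
    ∫ y in (0:ℝ)..z, (z - y) ^ β * w y =
      (1 / (β + 1)) * (w 0 * z ^ (β + 1) + ∫ y in (0:ℝ)..z, (z - y) ^ (β + 1) * w1 y) := by
  have hb : β + 1 ≠ 0 := by linarith
  have h := intervalIntegral.integral_mul_deriv_eq_deriv_mul_of_hasDeriv_right
    (a := 0) (b := z) (u := w) (u' := w1) (v := fun y => -(1 / (β + 1)) * (z - y) ^ (β + 1))
    (v' := fun y => (z - y) ^ β) (by rwa [uIcc_of_le hz]) ?_ (fun x _ => hd x) ?_ hi ?_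
  · have e1 : ∫ y in (0:ℝ)..z, (z - y) ^ β * w y = ∫ y in (0:ℝ)..z, w y * (z - y) ^ β := by
      congr 1; ext y; ring
    rw [e1, h]
    have e2 : ∫ y in (0:ℝ)..z, w1 y * (-(1 / (β + 1)) * (z - y) ^ (β + 1)) =
        -(1 / (β + 1)) * ∫ y in (0:ℝ)..z, (z - y) ^ (β + 1) * w1 y := by
      rw [← intervalIntegral.integral_const_mul]
      congr 1; ext y; ring
    rw [e2]
    simp only [sub_self, sub_zero, Real.zero_rpow hb]
    ring
  · apply ContinuousOn.mul continuousOn_const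
    apply ContinuousOn.rpow_const (by fun_prop)
    intro y _; right; linarith
  · intro y hy
    rw [min_eq_left hz, max_eq_right hz] at hy
    have h1 := (Real.hasDerivAt_rpow_const (x := z - y) (p := β + 1)
      (Or.inl (by linarith [hy.2] : z - y ≠ 0)))
    have h2 := ((h1.comp_const_sub z y).const_mul (-(1 / (β + 1)))).hasDerivWithinAt (s := Ioi y)
    refine h2.congr_deriv ?_
    rw [add_sub_cancel_right]
    field_simp
  · have h1 := (intervalIntegral.intervalIntegrable_rpow' (a := 0) (b := z) hβ).comp_sub_left z
    simpa using h1.symm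

lemma maxpow_sub_le (β a b s : ℝ) (hβ : 0 < β) (hβ1 : β ≤ 1) (hab : a ≤ b) :
    (max (s - a) 0) ^ β - (max (s - b) 0) ^ β ≤ (b - a) ^ β := by
  have h1 : max (s - a) 0 ≤ max (s - b) 0 + (b - a) := by
    apply max_le
    · linarith [le_max_left (s - b) 0]
    · linarith [le_max_right (s - b) 0]
  have h2 := Real.rpow_add_le_add_rpow (le_max_right (s - b) 0) (sub_nonneg.2 hab) hβ.le hβ1
  have h3 := Real.rpow_le_rpow (le_max_right (s - a) 0) h1 hβ.le
  linarith

lemma maxpow_cont (β : ℝ) (hβ : 0 < β) : Continuous (fun s : ℝ => (max s 0) ^ β) :=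
  Continuous.rpow_const (by fun_prop) (fun _ => Or.inr hβ.le)

lemma H_lip1 (β a b M : ℝ) (hβ : 0 < β) (hβ1 : β ≤ 1) (hab : a ≤ b) (w : ℝ → ℝ)
    (hw : Measurable w) (hwM : ∀ y, |w y| ≤ M) (x x' : ℝ) (hx : x ≤ x') :
    |(∫ y in Icc a b, (max (x' - y) 0) ^ β * w y) - ∫ y in Icc a b, (max (x - y) 0) ^ β * w y|
      ≤ M * (b - a) ^ β * (x' - x) := by
  have hM : 0 ≤ M := (abs_nonneg _).trans (hwM 0)
  have hc := maxpow_cont β hβ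
  have hc' : ∀ x : ℝ, Continuous fun y : ℝ => (max (x - y) 0) ^ β := fun x =>
    hc.comp (by fun_prop : Continuous fun y : ℝ => x - y)
  have hci : ∀ x : ℝ, IntegrableOn (fun y : ℝ => (max (x - y) 0) ^ β) (Icc a b) := fun x =>
    (hc' x).continuousOn.integrableOn_compact isCompact_Icc
  have hi : ∀ x : ℝ, IntegrableOn (fun y : ℝ => (max (x - y) 0) ^ β * w y) (Icc a b) := fun x =>
    Integrable.mul_bdd (hci x) (hw.aestronglyMeasurable) (c := M) (Eventually.of_forall hwM)
  rw [← integral_sub (hi x') (hi x)]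
  have h1 : |∫ y in Icc a b, ((max (x' - y) 0) ^ β * w y - (max (x - y) 0) ^ β * w y)| ≤
      ∫ y in Icc a b, M * ((max (x' - y) 0) ^ β - (max (x - y) 0) ^ β) := by
    rw [← Real.norm_eq_abs]
    refine norm_integral_le_of_norm_le (((hci x').sub (hci x)).const_mul M) ?_
    refine Eventually.of_forall fun y => ?_
    have : (max (x - y) 0) ^ β ≤ (max (x' - y) 0) ^ β :=
      Real.rpow_le_rpow (le_max_right _ _) (max_le_max (by linarith) le_rfl) hβ.le
    rw [← sub_mul, Real.norm_eq_abs, abs_mul, abs_of_nonneg (by linarith), mul_comm]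
    exact mul_le_mul_of_nonneg_right (hwM y) (by linarith)
  refine h1.trans ?_
  rw [integral_const_mul, mul_assoc]
  refine mul_le_mul_of_nonneg_left ?_ hM
  rw [integral_sub (hci x') (hci x), integral_Icc_eq_integral_Ioc, integral_Icc_eq_integral_Ioc,
    ← intervalIntegral.integral_of_le hab, ← intervalIntegral.integral_of_le hab,
    intervalIntegral.integral_comp_sub_left (fun s => (max s 0) ^ β),
    intervalIntegral.integral_comp_sub_left (fun s => (max s 0) ^ β),
    intervalIntegral.integral_interval_sub_interval_comm' (hc.intervalIntegrable _ _)
      (hc.intervalIntegrable _ _) (hc.intervalIntegrable _ _),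
    ← intervalIntegral.integral_comp_sub_right (fun s => (max s 0) ^ β),
    ← intervalIntegral.integral_comp_sub_right (fun s => (max s 0) ^ β)]
  have hd : ∀ a : ℝ, IntervalIntegrable (fun y : ℝ => (max (y - a) 0) ^ β) volume x x' := fun a =>
    (hc.comp (by fun_prop : Continuous fun y : ℝ => y - a)).intervalIntegrable _ _
  rw [← intervalIntegral.integral_sub (hd a) (hd b)]
  have := intervalIntegral.integral_mono_on hx ((hd a).sub (hd b))
    (intervalIntegrable_const (c := (b - a) ^ β))
    (fun s _ => maxpow_sub_le β a b s hβ hβ1 hab)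
  simpa [mul_comm] using this

lemma H_deriv_le (β a b M : ℝ) (hβ : 0 < β) (hβ1 : β ≤ 1) (hab : a ≤ b) (w : ℝ → ℝ)
    (hw : Measurable w) (hwM : ∀ y, |w y| ≤ M) (x : ℝ) :
    |deriv (fun z => ∫ y in Icc a b, (max (z - y) 0) ^ β * w y) x| ≤ M * (b - a) ^ β := by
  have hM : 0 ≤ M := (abs_nonneg _).trans (hwM 0)
  have h0 : 0 ≤ (b - a) ^ β := Real.rpow_nonneg (by linarith) _
  rw [← Real.norm_eq_abs]
  refine norm_deriv_le_of_lip' (by positivity) (Eventually.of_forall fun z => ?_)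
  rw [Real.norm_eq_abs, Real.norm_eq_abs]
  rcases le_total x z with h | h
  · rw [abs_of_nonneg (sub_nonneg.2 h)]
    exact H_lip1 β a b M hβ hβ1 hab w hw hwM x z h
  · rw [abs_sub_comm, abs_sub_comm z x, abs_of_nonneg (sub_nonneg.2 h)]
    exact H_lip1 β a b M hβ hβ1 hab w hw hwM z x h

lemma bdd_ii (w : ℝ → ℝ) (hw : Measurable w) (M : ℝ) (hM : ∀ y, |w y| ≤ M) (a b : ℝ) :
    IntervalIntegrable w volume a b := by
  refine (intervalIntegrable_const (c := M)).mono_fun' hw.aestronglyMeasurable ?_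
  exact Eventually.of_forall hM

lemma near_bound (α : ℝ) (h1 : 1 < α) (h2 : α < 2) (u u1 u2 : ℝ → ℝ) (a b M1 M2 x : ℝ)
    (ha : 0 ≤ a) (hab : a ≤ b)
    (hx0 : 0 < x) (hx1 : x < 1)
    (hu : ContinuousOn u (Ico 0 1)) (hu1 : ContinuousOn u1 (Ico 0 1))
    (m1 : Measurable u1) (m2 : Measurable u2)
    (b1 : ∀ y, |u1 y| ≤ M1) (b2 : ∀ y, |u2 y| ≤ M2)
    (d1 : ∀ y, HasDerivWithinAt u (u1 y) (Ioi y) y)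
    (d2 : ∀ y, HasDerivWithinAt u1 (u2 y) (Ioi y) y)
    (s2 : ∀ y, y ∉ Icc a b → u2 y = 0)
    (u0 : u 0 = 0) :
    |deriv (deriv (fun z => ∫ y in (0:ℝ)..z, (z - y) ^ (1 - α) * u y)) x| ≤
      M1 * x ^ (1 - α) + M2 * (b - a) ^ (2 - α) / (2 - α) := by
  have hF : ∀ z ∈ Ioo (0:ℝ) 1, ∫ y in (0:ℝ)..z, (z - y) ^ (1 - α) * u y =
      (1 / (2 - α)) * ((1 / (3 - α)) * (u1 0 * z ^ (3 - α) +
        ∫ y in Icc a b, (max (z - y) 0) ^ (3 - α) * u2 y)) := by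
    intro z hz
    have hsub : Icc 0 z ⊆ Ico 0 1 := fun y hy => ⟨hy.1, hy.2.trans_lt hz.2⟩
    rw [ibp (1 - α) (by linarith) u u1 z hz.1.le (hu.mono hsub) d1 (bdd_ii u1 m1 M1 b1 _ _), u0]
    rw [show 1 - α + 1 = 2 - α by ring,
      ibp (2 - α) (by linarith) u1 u2 z hz.1.le (hu1.mono hsub) d2 (bdd_ii u2 m2 M2 b2 _ _),
      show 2 - α + 1 = 3 - α by ring, zero_mul, zero_add]
    congr 4
    rw [intervalIntegral.integral_of_le hz.1.le, ← integral_Icc_eq_integral_Ioc]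
    have e1 : ∫ y in Icc 0 z, (z - y) ^ (3 - α) * u2 y =
        ∫ y in Icc 0 z, (max (z - y) 0) ^ (3 - α) * u2 y := by
      refine setIntegral_congr_fun measurableSet_Icc fun y hy => ?_
      rw [max_eq_left (by linarith [hy.2])]
    rw [e1, setIntegral_eq_integral_of_forall_compl_eq_zero,
      setIntegral_eq_integral_of_forall_compl_eq_zero]
    · intro y hy; rw [s2 y hy, mul_zero]
    · intro y hy
      by_cases h : y < 0
      · rw [s2 y (fun h' => by linarith [h'.1]), mul_zero]
      · have : z < y := by
          by_contra h'
          exact hy ⟨not_lt.1 h, not_lt.1 h'⟩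
        rw [max_eq_right (by linarith), Real.zero_rpow (by linarith), zero_mul]
  set H : ℝ → ℝ := fun z => ∫ y in Icc a b, (max (z - y) 0) ^ (2 - α) * u2 y with hH
  have hF' : ∀ z ∈ Ioo (0:ℝ) 1, HasDerivAt
      (fun z => ∫ y in (0:ℝ)..z, (z - y) ^ (1 - α) * u y)
      ((1 / (2 - α)) * (u1 0 * z ^ (2 - α) + H z)) z := by
    intro z hz
    have hD := conv_hasDerivAt (fun s => (max s 0) ^ (3 - α))
      (fun s => (3 - α) * (max s 0) ^ (3 - α - 1)) u2 a b z
      ((3 - α) * (max (z + 1 - a) 0) ^ (3 - α - 1)) M2 1 one_pos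
      (maxpow_cont _ (by linarith)).measurable
      ((maxpow_cont _ (by linarith)).measurable.const_mul _) m2 b2
      (fun z' _ y _ => maxpow_hasDerivAt _ (by linarith) _) ?_
    · have hP := (Real.hasDerivAt_rpow_const (x := z) (p := 3 - α)
        (Or.inr (by linarith))).const_mul (u1 0)
      have hS := ((hP.add hD).const_mul (1 / (3 - α))).const_mul (1 / (2 - α))
      have hS2 := hS.congr_of_eventuallyEq (f₁ := fun z => ∫ y in (0:ℝ)..z, (z - y) ^ (1 - α) * u y)
        (by
          filter_upwards [Ioo_mem_nhds hz.1 hz.2] with t ht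
          exact hF t ht)
      refine hS2.congr_deriv ?_
      have e : ∫ y in Icc a b, (3 - α) * (max (z - y) 0) ^ (3 - α - 1) * u2 y = (3 - α) * H z := by
        rw [hH, ← integral_const_mul]
        congr 1; ext y
        rw [show 3 - α - 1 = 2 - α by ring]; ring
      rw [e, show 3 - α - 1 = 2 - α by ring]
      have : 3 - α ≠ 0 := by linarith
      field_simp
    · intro z' hz' y hy
      rw [abs_of_nonneg (mul_nonneg (by linarith) (Real.rpow_nonneg (le_max_right _ _) _))]
      refine mul_le_mul_of_nonneg_left ?_ (by linarith)
      refine Real.rpow_le_rpow (le_max_right _ _) (max_le_max ?_ le_rfl) (by linarith)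
      rw [Metric.mem_ball, Real.dist_eq] at hz'
      linarith [(abs_lt.1 hz').2, hy.1]
  have hev : deriv (fun z => ∫ y in (0:ℝ)..z, (z - y) ^ (1 - α) * u y) =ᶠ[𝓝 x]
      fun z => (1 / (2 - α)) * (u1 0 * z ^ (2 - α) + H z) := by
    filter_upwards [Ioo_mem_nhds hx0 hx1] with t ht
    exact (hF' t ht).deriv
  rw [hev.deriv_eq]
  have hM1 : 0 ≤ M1 := (abs_nonneg _).trans (b1 0)
  have hM2 : 0 ≤ M2 := (abs_nonneg _).trans (b2 0)
  have hpa : 0 < 2 - α := by linarith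
  have hba : 0 ≤ (b - a) ^ (2 - α) := Real.rpow_nonneg (by linarith) _
  have hxx : 0 ≤ x ^ (1 - α) := Real.rpow_nonneg hx0.le _
  rw [deriv_const_mul_field]
  have hP := (Real.hasDerivAt_rpow_const (x := x) (p := 2 - α)
        (Or.inl hx0.ne')).const_mul (u1 0)
  by_cases hdH : DifferentiableAt ℝ H x
  · have := hP.add hdH.hasDerivAt
    have h3 : deriv (fun z => u1 0 * z ^ (2 - α) + H z) x = _ := this.deriv
    rw [h3]
    have hb := H_deriv_le (2 - α) a b M2 hpa (by linarith) hab u2 m2 b2 x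
    rw [show 2 - α - 1 = 1 - α by ring]
    have e : 1 / (2 - α) * (u1 0 * ((2 - α) * x ^ (1 - α)) + deriv H x) =
       u1 0 * x ^ (1 - α) + deriv H x / (2 - α) := by field_simp
    rw [e]
    refine (abs_add_le _ _).trans (add_le_add ?_ ?_)
    · rw [abs_mul, abs_of_nonneg hxx]
      exact mul_le_mul_of_nonneg_right (b1 0) hxx
    · rw [abs_div, abs_of_pos hpa]
      exact div_le_div_of_nonneg_right hb hpa.le
  · rw [deriv_zero_of_not_differentiableAt]
    · simp; positivity
    · intro h
      apply hdH
      have := h.sub hP.differentiableAt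
      refine this.congr_of_eventuallyEq (Eventually.of_forall fun z => ?_)
      simp

lemma far_deriv (γ : ℝ) (hγ : γ ≤ 0) (u : ℝ → ℝ) (a b M x : ℝ) (hx : b < x)
    (m : Measurable u) (bd : ∀ y, |u y| ≤ M) :
    HasDerivAt (fun z => ∫ y in Icc a b, (z - y) ^ γ * u y)
      (γ * ∫ y in Icc a b, (x - y) ^ (γ - 1) * u y) x := by
  have hD := conv_hasDerivAt (fun s => s ^ γ) (fun s => γ * s ^ (γ - 1)) u a b x
    (|γ| * ((x - b) / 2) ^ (γ - 1)) M ((x - b) / 2) (by linarith)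
    (by fun_prop) (by fun_prop) m bd ?_ ?_
  · refine hD.congr_deriv ?_
    rw [← integral_const_mul]
    congr 1; ext y; ring
  · intro z hz y hy
    rw [Metric.mem_ball, Real.dist_eq] at hz
    have := (abs_lt.1 hz).1
    exact Real.hasDerivAt_rpow_const (Or.inl (by linarith [hy.2] : z - y ≠ 0))
  · intro z hz y hy
    rw [Metric.mem_ball, Real.dist_eq] at hz
    have := (abs_lt.1 hz).1
    have h0 : (x - b) / 2 ≤ z - y := by linarith [hy.2]
    rw [abs_mul, abs_of_nonneg (Real.rpow_nonneg (by linarith) _)]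
    refine mul_le_mul_of_nonneg_left ?_ (abs_nonneg _)
    exact Real.rpow_le_rpow_of_nonpos (by linarith) h0 (by linarith)

lemma far_bound (α : ℝ) (h1 : 1 < α) (h2 : α < 2) (u : ℝ → ℝ) (a b M x : ℝ)
    (ha : 0 ≤ a) (hab : a ≤ b) (hx : b < x) (m : Measurable u) (bd : ∀ y, |u y| ≤ M)
    (s : ∀ y, y ∉ Icc a b → u y = 0) :
    |deriv (deriv (fun z => ∫ y in (0:ℝ)..z, (z - y) ^ (1 - α) * u y)) x| ≤
      (α - 1) * α * ((x - b) ^ (-1 - α) * M * (b - a)) := by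
  have hF : ∀ z, b < z → ∫ y in (0:ℝ)..z, (z - y) ^ (1 - α) * u y =
      ∫ y in Icc a b, (z - y) ^ (1 - α) * u y := by
    intro z hz
    rw [intervalIntegral.integral_of_le (by linarith), ← integral_Icc_eq_integral_Ioc]
    refine setIntegral_eq_of_subset_of_forall_sdiff_eq_zero measurableSet_Icc ?_ ?_
    · exact Icc_subset_Icc ha hz.le
    · intro y hy; rw [s y hy.2, mul_zero]
  have hF' : ∀ z, b < z → HasDerivAt (fun z => ∫ y in (0:ℝ)..z, (z - y) ^ (1 - α) * u y)
      ((1 - α) * ∫ y in Icc a b, (z - y) ^ (-α) * u y) z := by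
    intro z hz
    have := (far_deriv (1 - α) (by linarith) u a b M z hz m bd).congr_of_eventuallyEq
      (f₁ := fun z => ∫ y in (0:ℝ)..z, (z - y) ^ (1 - α) * u y) (by
        filter_upwards [Ioi_mem_nhds hz] with t ht
        exact hF t ht)
    rwa [show 1 - α - 1 = -α by ring] at this
  have hev : deriv (fun z => ∫ y in (0:ℝ)..z, (z - y) ^ (1 - α) * u y) =ᶠ[𝓝 x]
      fun z => (1 - α) * ∫ y in Icc a b, (z - y) ^ (-α) * u y := by
    filter_upwards [Ioi_mem_nhds hx] with t ht
    exact (hF' t ht).deriv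
  rw [hev.deriv_eq, ((far_deriv (-α) (by linarith) u a b M x hx m bd).const_mul (1 - α)).deriv,
    ← mul_assoc, show (1 - α) * -α = (α - 1) * α by ring, abs_mul,
    abs_of_pos (by nlinarith : 0 < (α - 1) * α)]
  refine mul_le_mul_of_nonneg_left ?_ (by nlinarith)
  have := norm_setIntegral_le_of_norm_le_const (μ := volume) (s := Icc a b)
    (f := fun y => (x - y) ^ (-α - 1) * u y) (C := (x - b) ^ (-1 - α) * M) (by simp) ?_
  · simpa [hab] using this
  · intro y hy
    have h3 : 0 ≤ (x - y) ^ (-α - 1) := Real.rpow_nonneg (by linarith [hy.2]) _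
    rw [Real.norm_eq_abs, abs_mul, abs_of_nonneg h3, show -1 - α = -α - 1 by ring]
    refine mul_le_mul ?_ (bd y) (abs_nonneg _) (Real.rpow_nonneg (by linarith) _)
    exact Real.rpow_le_rpow_of_nonpos (by linarith) (by linarith [hy.2]) (by linarith)

lemma pre_zero (α : ℝ) (u : ℝ → ℝ) (a x : ℝ) (hx0 : 0 < x) (hx : x < a)
    (s : ∀ y, y < a → u y = 0) :
    deriv (deriv (fun z => ∫ y in (0:ℝ)..z, (z - y) ^ (1 - α) * u y)) x = 0 := by
  have hF : ∀ z ∈ Ioo 0 a, ∫ y in (0:ℝ)..z, (z - y) ^ (1 - α) * u y = 0 := by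
    intro z hz
    rw [intervalIntegral.integral_of_le hz.1.le]
    refine setIntegral_eq_zero_of_forall_eq_zero fun y hy => ?_
    rw [s y (hy.2.trans_lt hz.2), mul_zero]
  have hev : (fun z => ∫ y in (0:ℝ)..z, (z - y) ^ (1 - α) * u y) =ᶠ[𝓝 x] fun _ => 0 := by
    filter_upwards [Ioo_mem_nhds hx0 hx] with t ht
    exact hF t ht
  rw [hev.deriv.deriv_eq]
  simp

lemma knot_eq (p n i : ℕ) (hn : 1 ≤ n) : knot p n i = ((min (i - (p + 1)) n : ℕ) : ℝ) / n := by
  have hn' : (n : ℝ) ≠ 0 := by positivity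
  unfold knot
  split_ifs with h1 h2
  · rw [Nat.sub_eq_zero_of_le h1]; simp
  · rw [min_eq_right (by omega), div_self hn']
  · rw [min_eq_left (by omega), Nat.cast_sub (by omega)]; push_cast; ring

lemma knot_mono (p n : ℕ) (hn : 1 ≤ n) {i j : ℕ} (h : i ≤ j) : knot p n i ≤ knot p n j := by
  rw [knot_eq _ _ _ hn, knot_eq _ _ _ hn]
  have : min (i - (p + 1)) n ≤ min (j - (p + 1)) n := by omega
  gcongr

lemma knot_nonneg (p n i : ℕ) (hn : 1 ≤ n) : 0 ≤ knot p n i := by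
  rw [knot_eq _ _ _ hn]; positivity

lemma knot_le_one (p n i : ℕ) (hn : 1 ≤ n) : knot p n i ≤ 1 := by
  rw [knot_eq _ _ _ hn]
  have hn' : (0:ℝ) < n := by positivity
  rw [div_le_one hn']
  exact_mod_cast min_le_right _ _

lemma knot_sub_le (p n i m : ℕ) (hn : 1 ≤ n) : knot p n (i + m) - knot p n i ≤ m / n := by
  rw [knot_eq _ _ _ hn, knot_eq _ _ _ hn, ← sub_div]
  have : ((min (i + m - (p + 1)) n : ℕ) : ℝ) ≤ (min (i - (p + 1)) n : ℕ) + (m : ℝ) := by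
    have : min (i + m - (p + 1)) n ≤ min (i - (p + 1)) n + m := by omega
    exact_mod_cast this
  gcongr
  linarith

lemma knot_inv_le (p n i m : ℕ) (hn : 1 ≤ n) : |(knot p n (i + m) - knot p n i)⁻¹| ≤ n := by
  have hn' : (0:ℝ) < n := by positivity
  rcases (knot_mono p n hn (Nat.le_add_right i m)).eq_or_lt with h | h
  · rw [h]; simp
  · rw [abs_of_pos (by simpa using h)]
    rw [inv_le_comm₀ (by linarith) hn']
    rw [knot_eq _ _ _ hn, knot_eq _ _ _ hn] at *
    rw [← sub_div, inv_eq_one_div]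
    have h3 : min (i - (p + 1)) n < min (i + m - (p + 1)) n := by
      have := (div_lt_div_iff_of_pos_right hn').1 h
      exact_mod_cast this
    have h4 : ((min (i - (p + 1)) n : ℕ) : ℝ) + 1 ≤ (min (i + m - (p + 1)) n : ℕ) := by
      exact_mod_cast h3
    gcongr
    linarith

lemma bs_succ (p n k i : ℕ) (x : ℝ) : bspline p n (k + 1) i x =
    (x - knot p n i) / (knot p n (i + k + 1) - knot p n i) * bspline p n k i x +
    (knot p n (i + k + 2) - x) / (knot p n (i + k + 2) - knot p n (i + 1))
      * bspline p n k (i + 1) x := by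
  rw [bspline]
  congr 1
  · split_ifs with h
    · rw [h]; simp
    · rfl
  · split_ifs with h
    · rw [h]; simp
    · rfl

lemma bs_supp (p n : ℕ) (hn : 1 ≤ n) (k : ℕ) : ∀ i x, (x < knot p n i ∨ knot p n (i + k + 1) ≤ x) →
    bspline p n k i x = 0 := by
  induction k with
  | zero =>
    intro i x h
    rw [bspline, if_neg]
    rintro ⟨h1, h2⟩
    rcases h with h | h
    · linarith
    · simp only [add_zero] at h; linarith
  | succ k ih =>
    intro i x h
    rw [bs_succ, ih i x, ih (i + 1) x]
    · simp
    · rcases h with h | h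
      · left; exact h.trans_le (knot_mono p n hn (by omega))
      · right; rw [show i + 1 + k + 1 = i + (k + 1) + 1 by ring]; exact h
    · rcases h with h | h
      · left; exact h
      · right; exact (knot_mono p n hn (by omega)).trans h

lemma bs_bound (p n : ℕ) (hn : 1 ≤ n) (k : ℕ) : ∀ i x, |bspline p n k i x| ≤ 2 ^ k := by
  induction k with
  | zero => intro i x; rw [bspline]; split_ifs <;> simp
  | succ k ih =>
    intro i x
    rw [bs_succ]
    have A : |(x - knot p n i) / (knot p n (i + k + 1) - knot p n i) * bspline p n k i x| ≤ 2 ^ k := by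
      by_cases h : x < knot p n i ∨ knot p n (i + k + 1) ≤ x
      · rw [bs_supp p n hn k i x h]; simp
      · push Not at h
        rw [abs_mul]
        have : |(x - knot p n i) / (knot p n (i + k + 1) - knot p n i)| ≤ 1 := by
          rw [abs_of_nonneg (div_nonneg (by linarith) (by linarith)), div_le_one (by linarith)]
          linarith
        nlinarith [abs_nonneg (bspline p n k i x), ih i x]
    have B : |(knot p n (i + k + 2) - x) / (knot p n (i + k + 2) - knot p n (i + 1))
      * bspline p n k (i + 1) x| ≤ 2 ^ k := by
      by_cases h : x < knot p n (i + 1) ∨ knot p n (i + 1 + k + 1) ≤ x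
      · rw [bs_supp p n hn k (i + 1) x h]; simp
      · rw [show i + 1 + k + 1 = i + k + 2 by ring] at h
        push Not at h
        rw [abs_mul]
        have : |(knot p n (i + k + 2) - x) / (knot p n (i + k + 2) - knot p n (i + 1))| ≤ 1 := by
          rw [abs_of_nonneg (div_nonneg (by linarith) (by linarith)), div_le_one (by linarith)]
          linarith
        nlinarith [abs_nonneg (bspline p n k (i + 1) x), ih (i + 1) x]
    refine (abs_add_le _ _).trans ?_
    rw [pow_succ]; linarith

lemma bs_meas (p n : ℕ) (k : ℕ) : ∀ i, Measurable (bspline p n k i) := by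
  induction k with
  | zero =>
    intro i
    have : bspline p n 0 i = fun x => if knot p n i ≤ x ∧ x < knot p n (i + 1) then (1:ℝ) else 0 := by
      ext x; rw [bspline]
    rw [this]
    exact Measurable.ite measurableSet_Ico measurable_const measurable_const
  | succ k ih =>
    intro i
    have : bspline p n (k + 1) i = fun x => _ := funext fun x => bs_succ p n k i x
    rw [this]
    have h1 := ih i
    have h2 := ih (i + 1)
    fun_prop

lemma bs_zero (p n : ℕ) (hn : 1 ≤ n) (k : ℕ) : ∀ i, p + 2 ≤ i + k → bspline p n k i 0 = 0 := by
  have hpos : ∀ i, p + 2 ≤ i → 0 < knot p n i := by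
    intro i hi
    rw [knot_eq _ _ _ hn]
    have : 0 < min (i - (p + 1)) n := by omega
    positivity
  induction k with
  | zero =>
    intro i hi
    rw [bspline, if_neg]
    intro h
    linarith [hpos i hi, h.1]
  | succ k ih =>
    intro i hi
    rw [bs_succ, ih (i + 1) (by omega)]
    by_cases h : p + 2 ≤ i
    · rw [ih i (by omega)]; simp
    · have : knot p n i = 0 := by unfold knot; rw [if_pos (by omega)]
      rw [this]; simp

noncomputable def D1 (p n k i : ℕ) (x : ℝ) : ℝ :=
  ((k : ℝ) + 1) * (bspline p n k i x * (knot p n (i + (k + 1)) - knot p n i)⁻¹ -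
    bspline p n k (i + 1) x * (knot p n (i + 1 + (k + 1)) - knot p n (i + 1))⁻¹)

lemma bs0_deriv (p n i : ℕ) (x : ℝ) : HasDerivWithinAt (bspline p n 0 i) 0 (Ioi x) x := by
  have hb : ∀ x, bspline p n 0 i x =
      if knot p n i ≤ x ∧ x < knot p n (i + 1) then (1:ℝ) else 0 := fun x => by rw [bspline]
  have : bspline p n 0 i =ᶠ[𝓝[>] x] fun _ => bspline p n 0 i x := by
    by_cases h1 : x < knot p n i
    · filter_upwards [nhdsWithin_le_nhds (Iio_mem_nhds h1)] with y hy
      rw [hb, hb, if_neg (by intro h; linarith [h.1, mem_Iio.1 hy]), if_neg (by intro h; linarith [h.1])]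
    · push Not at h1
      by_cases h2 : x < knot p n (i + 1)
      · filter_upwards [nhdsWithin_le_nhds (Iio_mem_nhds h2), self_mem_nhdsWithin] with y hy hy2
        rw [hb, hb, if_pos ⟨h1.trans (le_of_lt hy2), hy⟩, if_pos ⟨h1, h2⟩]
      · filter_upwards [self_mem_nhdsWithin] with y hy
        rw [hb, hb, if_neg (by intro h; linarith [h.2, mem_Ioi.1 hy]), if_neg (by intro h; linarith [h.2])]
  exact ((hasDerivWithinAt_const x (Ioi x) (bspline p n 0 i x))).congr_of_eventuallyEq this rfl

lemma bs_step (p n k i : ℕ) (x e1 e2 : ℝ)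
    (h1 : HasDerivWithinAt (bspline p n k i) e1 (Ioi x) x)
    (h2 : HasDerivWithinAt (bspline p n k (i + 1)) e2 (Ioi x) x) :
    HasDerivWithinAt (bspline p n (k + 1) i)
      ((1 / (knot p n (i + k + 1) - knot p n i) * bspline p n k i x +
        (x - knot p n i) / (knot p n (i + k + 1) - knot p n i) * e1) +
       (-1 / (knot p n (i + k + 2) - knot p n (i + 1)) * bspline p n k (i + 1) x +
        (knot p n (i + k + 2) - x) / (knot p n (i + k + 2) - knot p n (i + 1)) * e2)) (Ioi x) x := by
  have : bspline p n (k + 1) i = fun x => _ := funext fun x => bs_succ p n k i x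
  rw [this]
  have a1 := (((hasDerivWithinAt_id x (Ioi x)).sub_const (knot p n i)).div_const
    (knot p n (i + k + 1) - knot p n i)).mul h1
  have a2 := (((hasDerivWithinAt_id x (Ioi x)).const_sub (knot p n (i + k + 2))).div_const
    (knot p n (i + k + 2) - knot p n (i + 1))).mul h2
  exact a1.add a2

lemma bs_deriv (p n : ℕ) (hn : 1 ≤ n) (k : ℕ) : ∀ i x,
    HasDerivWithinAt (bspline p n (k + 1) i) (D1 p n k i x) (Ioi x) x := by
  induction k with
  | zero =>
    intro i x
    refine (bs_step p n 0 i x 0 0 (bs0_deriv _ _ _ _) (bs0_deriv _ _ _ _)).congr_deriv ?_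
    rw [D1]
    rw [show i + 1 + (0 + 1) = i + 0 + 2 by ring, show i + (0 + 1) = i + 0 + 1 by ring]
    push_cast; ring
  | succ k ih =>
    intro i x
    refine (bs_step p n (k + 1) i x _ _ (ih i x) (ih (i + 1) x)).congr_deriv ?_
    rw [D1, D1, D1]
    simp only [bs_succ p n k]
    simp only [show i + 1 + 1 = i + 2 by ring, show i + (k + 1) = i + k + 1 by ring,
      show i + 1 + (k + 1) = i + k + 2 by ring, show i + 2 + (k + 1) = i + k + 3 by ring,
      show i + k + 1 + 1 = i + k + 2 by ring, show i + k + 1 + 2 = i + k + 3 by ring,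
      show i + (k + 1 + 1) = i + k + 2 by ring, show i + 1 + (k + 1 + 1) = i + k + 3 by ring,
      show i + 1 + k + 1 = i + k + 2 by ring, show i + 1 + k + 2 = i + k + 3 by ring]
    have m1 := knot_mono p n hn (show i ≤ i + 1 by omega)
    have m2 := knot_mono p n hn (show i + 1 ≤ i + k + 2 by omega)
    have m3 := knot_mono p n hn (show i + k + 2 ≤ i + k + 3 by omega)
    have m4 := knot_mono p n hn (show i + 1 ≤ i + 2 by omega)
    have m5 := knot_mono p n hn (show i + k + 1 ≤ i + k + 2 by omega)
    have m6 := knot_mono p n hn (show i + 2 ≤ i + k + 2 by omega)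
    have m7 := knot_mono p n hn (show i + 1 ≤ i + k + 1 by omega)
    generalize bspline p n k i x = N0
    generalize bspline p n k (i + 1) x = N1
    generalize bspline p n k (i + 2) x = N2
    generalize knot p n i = t0 at *
    generalize knot p n (i + 1) = t1 at *
    generalize knot p n (i + 2) = t2 at *
    generalize knot p n (i + k + 1) = s1 at *
    generalize knot p n (i + k + 2) = s2 at *
    generalize knot p n (i + k + 3) = s3 at *
    by_cases hz : s2 - t1 = 0
    · have : s1 = t1 := by linarith
      have : s2 = t1 := by linarith
      have : t2 = t1 := by linarith
      subst_vars
      simp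
      ring
    · have q : (s2 - t0) * (s2 - t0)⁻¹ = 1 := mul_inv_cancel₀ (by
        intro h; apply hz; linarith)
      have q' : (s3 - t1) * (s3 - t1)⁻¹ = 1 := mul_inv_cancel₀ (by
        intro h; apply hz; linarith)
      simp only [div_eq_mul_inv]
      generalize (s2 - t0)⁻¹ = v0 at *
      generalize (s3 - t1)⁻¹ = v1 at *
      push_cast
      linear_combination (N1 * (s2 - t1)⁻¹ * (k + 1)) * (q' - q)

lemma D1_meas (p n k i : ℕ) : Measurable (D1 p n k i) := by
  have h1 := bs_meas p n k i
  have h2 := bs_meas p n k (i + 1)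
  unfold D1
  fun_prop

lemma D1_bound (p n : ℕ) (hn : 1 ≤ n) (k i : ℕ) (x : ℝ) :
    |D1 p n k i x| ≤ (k + 1) * (2 * 2 ^ k * n) := by
  rw [D1, abs_mul, abs_of_nonneg (by positivity : (0:ℝ) ≤ k + 1)]
  refine mul_le_mul_of_nonneg_left ?_ (by positivity)
  refine (abs_sub _ _).trans ?_
  rw [abs_mul, abs_mul]
  have := mul_le_mul (bs_bound p n hn k i x) (knot_inv_le p n i (k + 1) hn) (abs_nonneg _)
    (by positivity)
  have := mul_le_mul (bs_bound p n hn k (i + 1) x) (knot_inv_le p n (i + 1) (k + 1) hn)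
    (abs_nonneg _) (by positivity)
  linarith

lemma D1_supp (p n : ℕ) (hn : 1 ≤ n) (k i : ℕ) (x : ℝ)
    (h : x < knot p n i ∨ knot p n (i + k + 2) ≤ x) : D1 p n k i x = 0 := by
  rw [D1, bs_supp p n hn k i x, bs_supp p n hn k (i + 1) x]
  · simp
  · rcases h with h | h
    · left; exact h.trans_le (knot_mono p n hn (by omega))
    · right; exact (knot_mono p n hn (by omega)).trans h
  · rcases h with h | h
    · left; exact h
    · right; exact (knot_mono p n hn (by omega)).trans h

noncomputable def D2 (p n k i : ℕ) (x : ℝ) : ℝ :=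
  (((k + 1 : ℕ) : ℝ) + 1) * (D1 p n k i x * (knot p n (i + (k + 1 + 1)) - knot p n i)⁻¹ -
    D1 p n k (i + 1) x * (knot p n (i + 1 + (k + 1 + 1)) - knot p n (i + 1))⁻¹)

lemma D1_deriv (p n : ℕ) (hn : 1 ≤ n) (k i : ℕ) (x : ℝ) :
    HasDerivWithinAt (D1 p n (k + 1) i) (D2 p n k i x) (Ioi x) x := by
  have a1 := (bs_deriv p n hn k i x).mul_const (knot p n (i + (k + 1 + 1)) - knot p n i)⁻¹
  have a2 := (bs_deriv p n hn k (i + 1) x).mul_const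
    (knot p n (i + 1 + (k + 1 + 1)) - knot p n (i + 1))⁻¹
  exact (a1.sub a2).const_mul _

lemma D2_meas (p n k i : ℕ) : Measurable (D2 p n k i) := by
  have h1 := D1_meas p n k i
  have h2 := D1_meas p n k (i + 1)
  unfold D2
  fun_prop

lemma D2_bound (p n : ℕ) (hn : 1 ≤ n) (k i : ℕ) (x : ℝ) :
    |D2 p n k i x| ≤ (k + 2) * (2 * ((k + 1) * (2 * 2 ^ k * n)) * n) := by
  rw [D2, abs_mul, abs_of_nonneg (by positivity)]
  rw [show (((k + 1 : ℕ) : ℝ) + 1) = k + 2 by push_cast; ring]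
  refine mul_le_mul_of_nonneg_left ?_ (by positivity)
  refine (abs_sub _ _).trans ?_
  rw [abs_mul, abs_mul]
  have := mul_le_mul (D1_bound p n hn k i x) (knot_inv_le p n i (k + 1 + 1) hn) (abs_nonneg _)
    (by positivity)
  have := mul_le_mul (D1_bound p n hn k (i + 1) x) (knot_inv_le p n (i + 1) (k + 1 + 1) hn)
    (abs_nonneg _) (by positivity)
  linarith

lemma D2_supp (p n : ℕ) (hn : 1 ≤ n) (k i : ℕ) (x : ℝ)
    (h : x < knot p n i ∨ knot p n (i + k + 3) ≤ x) : D2 p n k i x = 0 := by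
  rw [D2, D1_supp p n hn k i x, D1_supp p n hn k (i + 1) x]
  · simp
  · rcases h with h | h
    · left; exact h.trans_le (knot_mono p n hn (by omega))
    · right; exact (knot_mono p n hn (by omega)).trans h
  · rcases h with h | h
    · left; exact h
    · right; exact (knot_mono p n hn (by omega)).trans h

/-- consecutive equal knots are at an endpoint -/
lemma knot_eq_succ (p n : ℕ) (hn : 1 ≤ n) (i : ℕ) (h : knot p n i = knot p n (i + 1)) :
    (knot p n i = 0 ∧ knot p n (i + 1) = 0) ∨ (knot p n i = 1 ∧ knot p n (i + 1) = 1) := by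
  by_cases h1 : i + 1 ≤ p + 1
  · left; constructor <;> (unfold knot; rw [if_pos (by omega)])
  · by_cases h2 : n + p + 1 ≤ i
    · right; constructor <;> (unfold knot; rw [if_neg (by omega), if_pos (by omega)])
    · exfalso
      rw [knot_eq _ _ _ hn, knot_eq _ _ _ hn] at h
      have hn' : (n : ℝ) ≠ 0 := by positivity
      have h3 : min (i - (p + 1)) n = min (i + 1 - (p + 1)) n := by
        field_simp at h
        exact_mod_cast h
      omega

lemma bs1_cont (p n : ℕ) (hn : 1 ≤ n) (i : ℕ) : ContinuousOn (bspline p n 1 i) (Ico 0 1) := by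
  have hb : ∀ i x, bspline p n 0 i x =
      if knot p n i ≤ x ∧ x < knot p n (i + 1) then (1:ℝ) else 0 := fun i x => by rw [bspline]
  have key : ∃ f : ℝ → ℝ, Continuous f ∧ ∀ x ∈ Ico (0:ℝ) 1, bspline p n 1 i x = f x := by
    have e : ∀ x, bspline p n 1 i x = _ := fun x => bs_succ p n 0 i x
    simp only [hb, add_zero, show i + 1 + 1 = i + 2 by ring] at e
    have m1 := knot_mono p n hn (show i ≤ i + 1 by omega)
    have m2 := knot_mono p n hn (show i + 1 ≤ i + 2 by omega)
    have e1 := knot_eq_succ p n hn i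
    have e2 := knot_eq_succ p n hn (i + 1)
    rw [show i + 1 + 1 = i + 2 by ring] at e2
    generalize knot p n i = t0 at *
    generalize knot p n (i + 1) = t1 at *
    generalize knot p n (i + 2) = t2 at *
    rcases m1.eq_or_lt with h1 | h1
    · rcases m2.eq_or_lt with h2 | h2
      · refine ⟨fun _ => 0, continuous_const, fun x _ => ?_⟩
        rw [e, h1, h2]; simp
      · rcases e1 h1 with ⟨ha, hb⟩ | ⟨ha, hb⟩
        · refine ⟨fun x => max 0 ((t2 - x) / (t2 - t1)), by fun_prop, fun x hx => ?_⟩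
          beta_reduce; rw [e, if_neg (by intro h; linarith [h.1, h.2] : ¬ (t0 ≤ x ∧ x < t1))]
          by_cases h3 : x < t2
          · rw [if_pos ⟨by linarith [hx.1], h3⟩, max_eq_right (div_nonneg (by linarith) (by linarith))]; simp
          · rw [if_neg (fun h => h3 h.2), max_eq_left (div_nonpos_of_nonpos_of_nonneg
              (by linarith) (by linarith))]; simp
        · refine ⟨fun _ => 0, continuous_const, fun x hx => ?_⟩
          rw [e, if_neg (by intro h; linarith [h.1, hx.2]), if_neg (by intro h; linarith [h.1, hx.2])]
          simp
    · rcases m2.eq_or_lt with h2 | h2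
      · rcases e2 h2 with ⟨ha, hb⟩ | ⟨ha, hb⟩
        · refine ⟨fun _ => 0, continuous_const, fun x hx => ?_⟩
          rw [e, if_neg (by intro h; linarith [h.2, hx.1]), if_neg (by intro h; linarith [h.2, hx.1])]
          simp
        · refine ⟨fun x => max 0 ((x - t0) / (t1 - t0)), by fun_prop, fun x hx => ?_⟩
          beta_reduce; rw [e, if_neg (by intro h; linarith [h.1, h.2] : ¬ (t1 ≤ x ∧ x < t2))]
          by_cases h3 : t0 ≤ x
          · rw [if_pos ⟨h3, by linarith [hx.2]⟩, max_eq_right (div_nonneg (by linarith) (by linarith))]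
            simp
          · rw [if_neg (fun h => h3 h.1), max_eq_left (div_nonpos_of_nonpos_of_nonneg
              (by linarith) (by linarith))]; simp
      · refine ⟨fun x => max 0 (min ((x - t0) / (t1 - t0)) ((t2 - x) / (t2 - t1))), by fun_prop,
          fun x hx => ?_⟩
        beta_reduce; rw [e]
        have p1 : 0 < t1 - t0 := by linarith
        have p2 : 0 < t2 - t1 := by linarith
        by_cases h3 : x < t0
        · rw [if_neg (by intro h; linarith [h.1]), if_neg (by intro h; linarith [h.1]), max_eq_left]
          · simp
          · exact (min_le_left _ _).trans (div_nonpos_of_nonpos_of_nonneg (by linarith) (by linarith))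
        · push Not at h3
          by_cases h4 : x < t1
          · have q1 : (x - t0) / (t1 - t0) ≤ 1 := by rw [div_le_one p1]; linarith
            have q2 : 1 ≤ (t2 - x) / (t2 - t1) := by rw [one_le_div p2]; linarith
            rw [if_pos ⟨h3, h4⟩, if_neg (by intro h; linarith [h.1]), min_eq_left (q1.trans q2),
              max_eq_right (div_nonneg (by linarith) p1.le)]
            simp
          · push Not at h4
            have q1 : 1 ≤ (x - t0) / (t1 - t0) := by rw [one_le_div p1]; linarith
            have q2 : (t2 - x) / (t2 - t1) ≤ 1 := by rw [div_le_one p2]; linarith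
            rw [if_neg (by intro h; linarith [h.2] : ¬ (t0 ≤ x ∧ x < t1)), min_eq_right (q2.trans q1)]
            by_cases h5 : x < t2
            · rw [if_pos ⟨h4, h5⟩, max_eq_right (div_nonneg (by linarith) p2.le)]
              simp
            · rw [if_neg (fun h => h5 h.2), max_eq_left (div_nonpos_of_nonpos_of_nonneg
                (by linarith) (by linarith))]; simp
  obtain ⟨f, hf, h⟩ := key
  exact hf.continuousOn.congr h

lemma bs_cont (p n : ℕ) (hn : 1 ≤ n) (k : ℕ) : ∀ i,
    ContinuousOn (bspline p n (k + 1) i) (Ico 0 1) := by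
  induction k with
  | zero => exact bs1_cont p n hn
  | succ k ih =>
    intro i
    have : bspline p n (k + 1 + 1) i = fun x => _ := funext fun x => bs_succ p n (k + 1) i x
    rw [this]
    exact ((by fun_prop : Continuous fun x : ℝ =>
        (x - knot p n i) / (knot p n (i + (k + 1) + 1) - knot p n i)).continuousOn.mul (ih i)).add
      ((by fun_prop : Continuous fun x : ℝ => (knot p n (i + (k + 1) + 2) - x) /
        (knot p n (i + (k + 1) + 2) - knot p n (i + 1))).continuousOn.mul (ih (i + 1)))

lemma D1_cont (p n : ℕ) (hn : 1 ≤ n) (k i : ℕ) : ContinuousOn (D1 p n (k + 1) i) (Ico 0 1) := by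
  unfold D1
  exact continuousOn_const.mul (((bs_cont p n hn k i).mul continuousOn_const).sub
    ((bs_cont p n hn k (i + 1)).mul continuousOn_const))

lemma schur {N : ℕ} (A : Matrix (Fin N) (Fin N) ℝ) (C : ℝ) (hC : 0 ≤ C)
    (hr : ∀ i, ∑ j, |A i j| ≤ C) (hc : ∀ j, ∑ i, |A i j| ≤ C) : matNorm2 A ≤ C := by
  unfold matNorm2
  refine ContinuousLinearMap.opNorm_le_bound _ hC fun v => ?_
  rw [LinearMap.coe_toContinuousLinearMap']
  rw [← abs_of_nonneg (norm_nonneg (Matrix.toEuclideanLin A v)),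
    ← abs_of_nonneg (mul_nonneg hC (norm_nonneg v))]
  rw [← sq_le_sq, mul_pow, EuclideanSpace.real_norm_sq_eq, EuclideanSpace.real_norm_sq_eq]
  have e : ∀ i, (Matrix.toEuclideanLin A v) i = ∑ j, A i j * v j := fun i => rfl
  have h1 : ∀ i, ((Matrix.toEuclideanLin A v) i) ^ 2 ≤ C * ∑ j, |A i j| * v j ^ 2 := by
    intro i
    rw [e]
    refine (Finset.sum_sq_le_sum_mul_sum_of_sq_le_mul Finset.univ (f := fun j => |A i j|)
      (g := fun j => |A i j| * v j ^ 2) (fun j _ => abs_nonneg _) (fun j _ => by positivity)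
      (fun j _ => ?_)).trans ?_
    · rw [mul_pow, ← sq_abs (A i j)]; apply le_of_eq; ring
    · exact mul_le_mul_of_nonneg_right (hr i) (Finset.sum_nonneg fun j _ => by positivity)
  calc ∑ i, ((Matrix.toEuclideanLin A v) i) ^ 2 ≤ ∑ i, C * ∑ j, |A i j| * v j ^ 2 :=
        Finset.sum_le_sum fun i _ => h1 i
    _ = C * ∑ j, (∑ i, |A i j|) * v j ^ 2 := by
        rw [← Finset.mul_sum, Finset.sum_comm]
        simp only [Finset.sum_mul]
    _ ≤ C * ∑ j, C * v j ^ 2 := by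
        refine mul_le_mul_of_nonneg_left (Finset.sum_le_sum fun j _ => ?_) hC
        exact mul_le_mul_of_nonneg_right (hc j) (by positivity)
    _ = C ^ 2 * ∑ j, v j ^ 2 := by rw [← Finset.mul_sum]; ring

noncomputable def gdec (d : ℤ) : ℝ := 1 / |(d : ℝ) + 1 / 2| ^ (2 : ℝ)

lemma gdec_nonneg (d : ℤ) : 0 ≤ gdec d := by unfold gdec; positivity

lemma gdec_summable : Summable gdec := (Real.summable_one_div_int_add_rpow (1 / 2) 2).2 (by norm_num)

lemma gdec_ge (p : ℕ) (d : ℤ) (m : ℝ) (hm : 1 ≤ m) (h : |(d : ℝ) + 1 / 2| ≤ (p + 2) * m) :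
    m ^ (-2 : ℝ) ≤ (p + 2) ^ 2 * gdec d := by
  have hne : (d : ℝ) + 1 / 2 ≠ 0 := by
    intro h0
    have h3 : ((2 * d + 1 : ℤ) : ℝ) = 0 := by push_cast; linarith
    have : 2 * d + 1 = 0 := by exact_mod_cast h3
    omega
  have hpos : 0 < |(d : ℝ) + 1 / 2| := abs_pos.2 hne
  unfold gdec
  rw [Real.rpow_neg (by linarith), Real.rpow_two, Real.rpow_two, inv_eq_one_div, mul_one_div,
    div_le_div_iff₀ (by positivity) (by positivity), one_mul, ← mul_pow]
  exact pow_le_pow_left₀ hpos.le h 2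

lemma grev_lo (p n i : ℕ) (hp : 2 ≤ p) (hn : 1 ≤ n) : 1 / (p * n : ℝ) ≤ greville p n (i + 2) := by
  have hp0 : (0:ℝ) < p := by positivity
  unfold greville
  rw [← div_div, div_right_comm]
  gcongr
  have h1 : knot p n (i + 2 + 1 + (p - 1)) ≤ ∑ j ∈ Finset.range p, knot p n (i + 2 + 1 + j) :=
    Finset.single_le_sum (f := fun j => knot p n (i + 2 + 1 + j))
      (fun j _ => knot_nonneg p n _ hn) (Finset.mem_range.2 (by omega))
  refine le_trans ?_ h1
  rw [knot_eq _ _ _ hn]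
  have : 1 ≤ min (i + 2 + 1 + (p - 1) - (p + 1)) n := by omega
  gcongr
  exact_mod_cast this

lemma grev_ge (p n i : ℕ) (hp : 2 ≤ p) (hn : 1 ≤ n) : knot p n (i + 1) ≤ greville p n i := by
  have hp0 : (0:ℝ) < p := by positivity
  unfold greville
  rw [le_div_iff₀ hp0]
  have := Finset.card_nsmul_le_sum (Finset.range p) (fun j => knot p n (i + 1 + j)) (knot p n (i + 1))
    (fun j _ => knot_mono p n hn (by omega))
  simpa [mul_comm] using this

lemma grev_le (p n i : ℕ) (hp : 2 ≤ p) (hn : 1 ≤ n) : greville p n i ≤ knot p n (i + p) := by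
  have hp0 : (0:ℝ) < p := by positivity
  unfold greville
  rw [div_le_iff₀ hp0]
  have := Finset.sum_le_card_nsmul (Finset.range p) (fun j => knot p n (i + 1 + j)) (knot p n (i + p))
    (fun j hj => knot_mono p n hn (by have := Finset.mem_range.1 hj; omega))
  simpa [mul_comm] using this

lemma grev_lt (p n i : ℕ) (hp : 2 ≤ p) (hn : 1 ≤ n) (hi : i < n + p) : greville p n i < 1 := by
  have hp0 : (0:ℝ) < p := by positivity
  have hn0 : (0:ℝ) < n := by positivity
  unfold greville
  rw [div_lt_one hp0]
  have : ∑ j ∈ Finset.range p, knot p n (i + 1 + j) < ∑ j ∈ Finset.range p, (1:ℝ) := by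
    refine Finset.sum_lt_sum (fun j _ => knot_le_one p n _ hn) ⟨0, Finset.mem_range.2 (by omega), ?_⟩
    rw [knot_eq _ _ _ hn, div_lt_one hn0]
    have : min (i + 1 + 0 - (p + 1)) n < n := by omega
    exact_mod_cast this
  simpa using this

lemma entry_near (q : ℕ) (α : ℝ) (h1 : 1 < α) (h2 : α < 2) : ∃ K ≥ (0:ℝ), ∀ n : ℕ, 1 ≤ n →
    ∀ i j : ℕ, i < n + q →
    |deriv (deriv (fun z => ∫ y in (0:ℝ)..z, (z - y) ^ (1 - α) * bspline (q + 2) n (q + 2) (j + 2) y))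
      (greville (q + 2) n (i + 2))| ≤ K * (n : ℝ) ^ α := by
  have hpa : 0 < 2 - α := by linarith
  refine ⟨(((q + 1 : ℕ) : ℝ) + 1) * (2 * 2 ^ (q + 1)) * ((q + 2 : ℕ) : ℝ) ^ (α - 1) +
    (q + 2) * (2 * ((q + 1) * (2 * 2 ^ q))) * ((q + 3 : ℕ) : ℝ) ^ (2 - α) / (2 - α), by positivity, ?_⟩
  intro n hn i j hi
  have hn0 : (0:ℝ) < n := by positivity
  set x := greville (q + 2) n (i + 2) with hx
  have hxlo : 1 / (((q + 2 : ℕ) : ℝ) * n) ≤ x := grev_lo (q + 2) n i (by omega) hn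
  have hx0 : 0 < x := lt_of_lt_of_le (by positivity) hxlo
  have hx1 : x < 1 := grev_lt (q + 2) n (i + 2) (by omega) hn (by omega)
  set a := knot (q + 2) n (j + 2)
  set b := knot (q + 2) n (j + 2 + (q + 3))
  have hab : a ≤ b := knot_mono _ n hn (by omega)
  have hba : b - a ≤ ((q + 3 : ℕ) : ℝ) / n := knot_sub_le (q + 2) n (j + 2) (q + 3) hn
  have hb := near_bound α h1 h2 (bspline (q + 2) n (q + 2) (j + 2)) (D1 (q + 2) n (q + 1) (j + 2))
    (D2 (q + 2) n q (j + 2)) a b _ _ x (knot_nonneg _ n _ hn) hab hx0 hx1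
    (bs_cont _ n hn (q + 1) _) (D1_cont _ n hn q _) (D1_meas _ _ _ _) (D2_meas _ _ _ _)
    (D1_bound _ n hn _ _) (D2_bound _ n hn _ _) (bs_deriv _ n hn _ _) (D1_deriv _ n hn _ _)
    (fun y hy => D2_supp _ n hn _ _ y (by
      by_contra h
      push Not at h
      exact hy ⟨h.1, h.2.le⟩)) (bs_zero _ n hn _ _ (by omega))
  refine hb.trans ?_
  have e1 : x ^ (1 - α) ≤ ((q + 2 : ℕ) : ℝ) ^ (α - 1) * (n : ℝ) ^ (α - 1) := by
    refine (Real.rpow_le_rpow_of_nonpos (by positivity) hxlo (by linarith)).trans (le_of_eq ?_)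
    rw [one_div, Real.inv_rpow (by positivity), ← Real.rpow_neg (by positivity), neg_sub,
      Real.mul_rpow (by positivity) (by positivity)]
  have e2 : (b - a) ^ (2 - α) ≤ ((q + 3 : ℕ) : ℝ) ^ (2 - α) * (n : ℝ) ^ (α - 2) := by
    refine (Real.rpow_le_rpow (by linarith) hba hpa.le).trans (le_of_eq ?_)
    rw [Real.div_rpow (by positivity) (by positivity), div_eq_mul_inv,
      ← Real.rpow_neg (by positivity), neg_sub]
  have f1 : (n : ℝ) ^ α = (n : ℝ) * (n : ℝ) ^ (α - 1) := by
    rw [← Real.rpow_one_add' (by positivity) (by linarith)]; congr 1; ring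
  have f2 : (n : ℝ) ^ α = (n : ℝ) * n * (n : ℝ) ^ (α - 2) := by
    rw [← pow_two, ← Real.rpow_natCast, ← Real.rpow_add hn0]; congr 1; push_cast; ring
  rw [add_mul _ _ ((n : ℝ) ^ α)]
  apply add_le_add
  · refine (mul_le_mul_of_nonneg_left e1 (by positivity)).trans (le_of_eq ?_)
    rw [f1]; ring
  · rw [div_mul_eq_mul_div]
    refine div_le_div_of_nonneg_right ?_ hpa.le
    refine (mul_le_mul_of_nonneg_left e2 (by positivity)).trans (le_of_eq ?_)
    rw [f2]; ring

lemma entry_far (q : ℕ) (α : ℝ) (h1 : 1 < α) (h2 : α < 2) : ∃ K ≥ (0:ℝ), ∀ n : ℕ, 1 ≤ n →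
    ∀ i j : ℕ, i < n + q → ∀ m : ℕ, 1 ≤ m → i = j + (q + 2) + m →
    |deriv (deriv (fun z => ∫ y in (0:ℝ)..z, (z - y) ^ (1 - α) * bspline (q + 2) n (q + 2) (j + 2) y))
      (greville (q + 2) n (i + 2))| ≤ K * (n : ℝ) ^ α * (m : ℝ) ^ (-2 : ℝ) := by
  have hpa : 0 < 2 - α := by linarith
  have hpb : 0 < α - 1 := by linarith
  refine ⟨(α - 1) * α * (2 ^ (q + 2) * ((q + 3 : ℕ) : ℝ)), by positivity, ?_⟩
  intro n hn i j hi m hm him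
  have hn0 : (0:ℝ) < n := by positivity
  have hm1 : (1:ℝ) ≤ m := by exact_mod_cast hm
  set x := greville (q + 2) n (i + 2) with hx
  set a := knot (q + 2) n (j + 2)
  set b := knot (q + 2) n (j + 2 + (q + 3)) with hbdef
  have hab : a ≤ b := knot_mono _ n hn (by omega)
  have hba : b - a ≤ ((q + 3 : ℕ) : ℝ) / n := knot_sub_le (q + 2) n (j + 2) (q + 3) hn
  have hxb : (m : ℝ) / n ≤ x - b := by
    have g1 : knot (q + 2) n (i + 2 + 1) ≤ x := grev_ge (q + 2) n (i + 2) (by omega) hn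
    have g2 : (m : ℝ) / n ≤ knot (q + 2) n (i + 2 + 1) - b := by
      rw [hbdef, knot_eq _ _ _ hn, knot_eq _ _ _ hn, ← sub_div]
      gcongr
      rw [le_sub_iff_add_le]
      have : m + min (j + 2 + (q + 3) - (q + 2 + 1)) n ≤ min (i + 2 + 1 - (q + 2 + 1)) n := by omega
      exact_mod_cast this
    linarith
  have hmn : 0 < (m : ℝ) / n := by positivity
  have hb := far_bound α h1 h2 (bspline (q + 2) n (q + 2) (j + 2)) a b _ x (knot_nonneg _ n _ hn)
    hab (by linarith) (bs_meas _ _ _ _) (bs_bound _ n hn _ _)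
    (fun y hy => bs_supp _ n hn _ _ y (by
      by_contra h
      push Not at h
      exact hy ⟨h.1, h.2.le⟩))
  refine hb.trans ?_
  rw [mul_assoc ((α - 1) * α), mul_assoc ((α - 1) * α)]
  refine mul_le_mul_of_nonneg_left ?_ (by positivity)
  have e1 : (x - b) ^ (-1 - α) ≤ (m : ℝ) ^ (-2 : ℝ) * (n : ℝ) ^ (1 + α) := by
    refine (Real.rpow_le_rpow_of_nonpos hmn hxb (by linarith)).trans ?_
    rw [Real.div_rpow (by positivity) (by positivity), div_eq_mul_inv,
      ← Real.rpow_neg (by positivity), show -(-1 - α) = 1 + α by ring]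
    gcongr
    linarith
  have f1 : (n : ℝ) ^ (1 + α) = (n : ℝ) * (n : ℝ) ^ α := by
    rw [← Real.rpow_one_add' (by positivity) (by linarith)]
  calc (x - b) ^ (-1 - α) * 2 ^ (q + 2) * (b - a)
      ≤ ((m : ℝ) ^ (-2 : ℝ) * (n : ℝ) ^ (1 + α)) * 2 ^ (q + 2) * (((q + 3 : ℕ) : ℝ) / n) := by
        refine mul_le_mul (mul_le_mul_of_nonneg_right e1 (by positivity)) hba (by linarith)
          (by positivity)
    _ = _ := by rw [f1]; field_simp

lemma entry_bound (q : ℕ) (α : ℝ) (h1 : 1 < α) (h2 : α < 2) : ∃ K ≥ (0:ℝ), ∀ n : ℕ, 1 ≤ n →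
    ∀ i j : Fin (n + (q + 2) - 2),
    |(((n : ℝ) ^ (-α)) • ALmat (q + 2) n α) i j| ≤ K * gdec ((i : ℤ) - j) := by
  obtain ⟨K1, hK1, H1⟩ := entry_near q α h1 h2
  obtain ⟨K2, hK2, H2⟩ := entry_far q α h1 h2
  set G := |1 / Real.Gamma (2 - α)| with hG
  have hG0 : 0 ≤ G := abs_nonneg _
  refine ⟨G * (K1 + K2) * (((q + 2 : ℕ) : ℝ) + 2) ^ 2, by positivity, ?_⟩
  intro n hn i j
  have hn0 : (0:ℝ) < n := by positivity
  have hi : (i : ℕ) < n + q := by have := i.2; omega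
  have hj : (j : ℕ) < n + q := by have := j.2; omega
  have hnn : (n : ℝ) ^ (-α) * (n : ℝ) ^ α = 1 := by
    rw [← Real.rpow_add hn0]; simp
  have hnp : 0 < (n : ℝ) ^ (-α) := Real.rpow_pos_of_pos hn0 _
  rw [Matrix.smul_apply, smul_eq_mul, ALmat, Matrix.of_apply, RLD0x, abs_mul, abs_mul,
    abs_of_pos hnp, ← hG]
  set E := |deriv (deriv (fun z => ∫ y in (0:ℝ)..z, (z - y) ^ (1 - α) *
    bspline (q + 2) n (q + 2) ((j : ℕ) + 2) y)) (greville (q + 2) n ((i : ℕ) + 2))| with hE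
  have key : ∀ m : ℝ, 1 ≤ m → |(((i : ℤ) - j : ℤ) : ℝ) + 1 / 2| ≤ (((q + 2 : ℕ) : ℝ) + 2) * m →
      E ≤ (K1 + K2) * (n : ℝ) ^ α * m ^ (-2 : ℝ) →
      (n : ℝ) ^ (-α) * (G * E) ≤ G * (K1 + K2) * (((q + 2 : ℕ) : ℝ) + 2) ^ 2 * gdec ((i : ℤ) - j) := by
    intro m hm hd hEm
    have := gdec_ge (q + 2) _ m hm hd
    calc (n : ℝ) ^ (-α) * (G * E)
        ≤ (n : ℝ) ^ (-α) * (G * ((K1 + K2) * (n : ℝ) ^ α * m ^ (-2 : ℝ))) := by gcongr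
      _ = ((n : ℝ) ^ (-α) * (n : ℝ) ^ α) * (G * (K1 + K2) * m ^ (-2 : ℝ)) := by ring
      _ = G * (K1 + K2) * m ^ (-2 : ℝ) := by rw [hnn, one_mul]
      _ ≤ G * (K1 + K2) * ((((q + 2 : ℕ) : ℝ) + 2) ^ 2 * gdec ((i : ℤ) - j)) := by gcongr
      _ = _ := by ring
  have hna : 0 ≤ (n : ℝ) ^ α := Real.rpow_nonneg hn0.le _
  by_cases c1 : (i : ℕ) + (q + 2) < j
  · have : E = 0 := by
      rw [hE, pre_zero α _ (knot (q + 2) n ((j : ℕ) + 2)), abs_zero]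
      · exact lt_of_lt_of_le (by positivity) (grev_lo (q + 2) n i (by omega) hn)
      · refine (grev_le (q + 2) n ((i : ℕ) + 2) (by omega) hn).trans_lt ?_
        rw [knot_eq _ _ _ hn, knot_eq _ _ _ hn]
        have : min ((i : ℕ) + 2 + (q + 2) - (q + 2 + 1)) n < min ((j : ℕ) + 2 - (q + 2 + 1)) n := by
          omega
        gcongr
      · intro y hy
        exact bs_supp _ n hn _ _ y (Or.inl hy)
    rw [this, mul_zero, mul_zero]
    have := gdec_nonneg ((i : ℤ) - j)
    positivity
  · by_cases c2 : (i : ℕ) ≤ j + (q + 2)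
    · refine key 1 le_rfl ?_ ?_
      · push_cast
        have a1 : ((i : ℕ) : ℝ) ≤ (j : ℕ) + (q + 2) := by exact_mod_cast c2
        have a2 : ((j : ℕ) : ℝ) ≤ (i : ℕ) + (q + 2) := by exact_mod_cast not_lt.1 c1
        rw [abs_le]; constructor <;> linarith
      · rw [Real.one_rpow, mul_one]
        refine (H1 n hn i j hi).trans ?_
        gcongr; linarith
    · obtain ⟨m, hm⟩ : ∃ m : ℕ, (i : ℕ) = j + (q + 2) + m := ⟨i - (j + (q + 2)), by omega⟩
      have hm1 : 1 ≤ m := by omega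
      have hm1' : (1:ℝ) ≤ m := by exact_mod_cast hm1
      refine key m hm1' ?_ ?_
      · rw [hm]
        push_cast
        have : (0:ℝ) ≤ q := by positivity
        rw [abs_le]; constructor <;> nlinarith
      · refine (H2 n hn i j hi m hm1 hm).trans ?_
        have : 0 ≤ (m : ℝ) ^ (-2 : ℝ) := by positivity
        gcongr; linarith

end

theorem stmt14 (p : ℕ) (hp : 2 ≤ p) (α : ℝ) (h1 : 1 < α) (h2 : α < 2) :
    ∃ C > (0 : ℝ), ∀ n : ℕ, 1 ≤ n →
      matNorm1 (((n : ℝ) ^ (-α)) • ALmat p n α) ≤ C ∧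
      matNorm2 (((n : ℝ) ^ (-α)) • ALmat p n α) ≤ C ∧
      matNormInf (((n : ℝ) ^ (-α)) • ALmat p n α) ≤ C := by
  obtain ⟨q, rfl⟩ : ∃ q, p = q + 2 := ⟨p - 2, by omega⟩
  obtain ⟨K, hK, H⟩ := entry_bound q α h1 h2
  have hS : 0 ≤ ∑' d, gdec d := tsum_nonneg gdec_nonneg
  have hC : 0 ≤ K * ∑' d, gdec d := mul_nonneg hK hS
  refine ⟨K * ∑' d, gdec d + 1, by linarith, ?_⟩
  intro n hn
  have inj : ∀ f : Fin (n + (q + 2) - 2) → ℤ, Function.Injective f →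
      ∑ k, gdec (f k) ≤ ∑' d, gdec d := by
    intro f hf
    rw [← tsum_fintype (L := SummationFilter.unconditional _)]
    exact tsum_comp_le_tsum_of_inj gdec_summable gdec_nonneg hf
  have hr : ∀ i, ∑ j, |(((n : ℝ) ^ (-α)) • ALmat (q + 2) n α) i j| ≤ K * ∑' d, gdec d + 1 := by
    intro i
    refine (Finset.sum_le_sum fun j _ => H n hn i j).trans ?_
    rw [← Finset.mul_sum]
    have := mul_le_mul_of_nonneg_left (inj (fun j => (i : ℤ) - j) (fun a b h => by
      apply Fin.ext; simp only at h; omega)) hK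
    linarith
  have hc : ∀ j, ∑ i, |(((n : ℝ) ^ (-α)) • ALmat (q + 2) n α) i j| ≤ K * ∑' d, gdec d + 1 := by
    intro j
    refine (Finset.sum_le_sum fun i _ => H n hn i j).trans ?_
    rw [← Finset.mul_sum]
    have := mul_le_mul_of_nonneg_left (inj (fun i => (i : ℤ) - j) (fun a b h => by
      apply Fin.ext; simp only at h; omega)) hK
    linarith
  refine ⟨?_, ?_, ?_⟩
  · exact Real.iSup_le hc (by linarith)
  · exact schur _ _ (by linarith) hr hc
  · exact Real.iSup_le hr (by linarith)
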